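/- Necessity of the degree condition in the multidimensional polynomial Bogolyubov theorem: Let P = (P₁, …, P_d) : ℤ^d → ℤ^d be an integer polynomial map with zero constant term and suppose there exist integers α₁, …, α_d, not all zero, and integers β₁, …, β_d such that Σ_{i=1}^d α_i P_i(x₁, …, x_d) = Σ_{i=1}^d β_i x_i for all (x₁, …, x_d) ∈ ℤ^d. Then there exists a set E ⊆ ℤ^d with upper Banach density d*(E) > 0 such that for every positive integer k one has kℤ^d ⊄ (E − E) + P(E − E). -/

import Mathlib

open MeasureTheory Filter
open scoped symmDiff

/-- Upper Banach density of a set `E ⊆ ℤ^d`: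
`d*(E) = limsup_N sup_t |E ∩ (Q_N + t)| / |Q_N|` where `Q_N = [-N, N]^d ∩ ℤ^d`. -/
noncomputable def upperBanachDensity (d : ℕ) (E : Set (Fin d → ℤ)) : ℝ :=
  Filter.atTop.limsup fun N : ℕ =>
    ⨆ t : Fin d → ℤ,
      ((E ∩ {x | ∀ i, |x i - t i| ≤ (N : ℤ)}).ncard : ℝ) / ((2 * N + 1 : ℝ) ^ d)

/-- Every irrational number has an integer multiple at distance at least `1 / 4` from `ℤ`. -/
theorem Irrational.exists_quarter_le_abs_mul_sub {φ : ℝ} (hφ : Irrational φ) :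
    ∃ n : ℤ, ∀ a : ℤ, 1 / 4 ≤ |n * φ - a| := by
  by_contra! h
  obtain ⟨a, ha⟩ := h 1
  have key : ∀ j : ℕ, |(2 : ℝ) ^ j * φ - 2 ^ j * a| < 1 / 4 := by
    intro j
    induction j with
    | zero => simpa using ha
    | succ j ih =>
      obtain ⟨b, hb⟩ := h (2 ^ (j + 1))
      have hba : b = 2 ^ (j + 1) * a := by
        rw [← sub_eq_zero, ← Int.abs_lt_one_iff]
        have : |((b - 2 ^ (j + 1) * a : ℤ) : ℝ)| < 1 := by
          push_cast at hb ⊢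
          rw [pow_succ] at hb ⊢
          rw [abs_lt] at *
          constructor <;> linarith
        exact_mod_cast this
      rw [hba] at hb
      exact_mod_cast hb
  have hpos : 0 < |φ - a| := abs_pos.2 (sub_ne_zero.2 (hφ.ne_int a))
  obtain ⟨j, hj⟩ := pow_unbounded_of_one_lt (1 / 4 / |φ - a|) (one_lt_two : (1 : ℝ) < 2)
  have := key j
  rw [← mul_sub, abs_mul, abs_of_pos (by positivity)] at this
  rw [div_lt_iff₀ hpos] at hj
  linarith

theorem setOf_abs_sub_le_eq_Icc {d : ℕ} (N : ℕ) (t : Fin d → ℤ) :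
    {x : Fin d → ℤ | ∀ i, |x i - t i| ≤ (N : ℤ)} =
      (Finset.Icc (fun i => t i - N) (fun i => t i + N) : Finset (Fin d → ℤ)) := by
  ext x
  simp only [Set.mem_ofPred_eq, Finset.coe_Icc, Set.mem_Icc, Pi.le_def, ← forall_and, abs_le]
  exact forall_congr' fun i => by constructor <;> rintro ⟨_, _⟩ <;> constructor <;> linarith

theorem card_Icc_sub_add {d : ℕ} (N : ℕ) (t : Fin d → ℤ) :
    ((Finset.Icc (fun i => t i - N) (fun i => t i + N) : Finset (Fin d → ℤ)).card : ℝ) =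
      (2 * N + 1) ^ d := by
  have h : ∀ i, (t i + N + 1 - (t i - N)).toNat = 2 * N + 1 := fun i => by omega
  simp [Pi.card_Icc, h]

/-- A set that fills a proportion at least `c` of some translate of every cube has upper Banach
density at least `c`. -/
theorem le_upperBanachDensity {d : ℕ} {E : Set (Fin d → ℤ)} {c : ℝ}
    (h : ∀ N : ℕ, ∃ t : Fin d → ℤ,
      c * (2 * N + 1) ^ d ≤ (E ∩ {x | ∀ i, |x i - t i| ≤ (N : ℤ)}).ncard) :
    c ≤ upperBanachDensity d E := by
  have hle : ∀ (N : ℕ) (t : Fin d → ℤ),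
      ((E ∩ {x | ∀ i, |x i - t i| ≤ (N : ℤ)}).ncard : ℝ) / ((2 * N + 1 : ℝ) ^ d) ≤ 1 := by
    intro N t
    rw [div_le_one (by positivity), ← card_Icc_sub_add N t, setOf_abs_sub_le_eq_Icc]
    have := Set.ncard_le_ncard (Set.inter_subset_right (s := E)) (Finset.finite_toSet
      (Finset.Icc (fun i => t i - N) (fun i => t i + N) : Finset (Fin d → ℤ)))
    rw [Set.ncard_coe_finset] at this
    exact_mod_cast this
  refine le_limsup_of_frequently_le (Frequently.of_forall fun N => ?_)
    (isBoundedUnder_of ⟨1, fun N => ciSup_le (hle N)⟩)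
  obtain ⟨t, ht⟩ := h N
  refine le_ciSup_of_le ⟨1, Set.forall_mem_range.2 (hle N)⟩ t ?_
  rwa [le_div_iff₀ (by positivity)]

/-- The Bohr set of those `x` for which `f x` and `g x` are within `1 / M` of integers has positive
upper Banach density. -/
theorem upperBanachDensity_bohr_pos {d M : ℕ} (hM : 0 < M) (f g : (Fin d → ℤ) →+ ℝ) :
    0 < upperBanachDensity d {x | (∃ a : ℤ, |f x - a| < 1 / M) ∧ ∃ b : ℤ, |g x - b| < 1 / M} := by
  have hM' : (0 : ℝ) < M := by exact_mod_cast hM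
  refine lt_of_lt_of_le (b := ((M : ℝ) * M)⁻¹) (by positivity)
    (le_upperBanachDensity fun N => ?_)
  let cell : ℝ → ℤ := fun y => ⌊M * Int.fract y⌋
  have hcell : ∀ y, cell y ∈ Finset.Ico (0 : ℤ) M := fun y => by
    rw [Finset.mem_Ico]
    refine ⟨Int.floor_nonneg.2 (by have := Int.fract_nonneg y; positivity), Int.floor_lt.2 ?_⟩
    have := Int.fract_lt_one y
    push_cast
    nlinarith
  have hclose : ∀ y z, cell y = cell z → ∃ a : ℤ, |y - z - a| < 1 / M := by
    intro y z hyz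
    refine ⟨⌊y⌋ - ⌊z⌋, ?_⟩
    have h1 := Int.abs_sub_lt_one_of_floor_eq_floor hyz
    rw [← mul_sub, abs_mul, abs_of_pos hM'] at h1
    rw [lt_div_iff₀ hM', mul_comm]
    have h2 : y - z - ((⌊y⌋ - ⌊z⌋ : ℤ) : ℝ) = Int.fract y - Int.fract z := by
      rw [← Int.self_sub_floor, ← Int.self_sub_floor]
      push_cast
      ring
    rwa [h2]
  set Q : Finset (Fin d → ℤ) := Finset.Icc (fun i => (0 : Fin d → ℤ) i - N)
    (fun i => (0 : Fin d → ℤ) i + N) with hQ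
  obtain ⟨y, -, hy⟩ := Finset.exists_le_card_fiber_of_nsmul_le_card_of_maps_to
    (s := Q) (t := Finset.Ico (0 : ℤ) M ×ˢ Finset.Ico (0 : ℤ) M)
    (f := fun x => (cell (f x), cell (g x))) (b := ((M : ℝ) * M)⁻¹ * (2 * N + 1) ^ d)
    (fun x _ => Finset.mem_product.2 ⟨hcell _, hcell _⟩)
    ⟨(0, 0), by simp [hM]⟩
    (by
      rw [hQ, card_Icc_sub_add]
      simp only [Finset.card_product, Int.card_Ico, sub_zero, Int.toNat_natCast, nsmul_eq_mul,
        Nat.cast_mul]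
      rw [mul_inv_cancel_left₀ (by positivity)])
  set F := Q.filter fun x => (cell (f x), cell (g x)) = y with hF
  obtain ⟨x₀, hx₀⟩ : F.Nonempty := by
    rw [← Finset.card_pos, ← Nat.cast_pos (α := ℝ)]
    exact lt_of_lt_of_le (by positivity) hy
  refine ⟨-x₀, hy.trans ?_⟩
  have hfin : {x : Fin d → ℤ | ∀ i, |x i - (-x₀) i| ≤ (N : ℤ)}.Finite := by
    rw [setOf_abs_sub_le_eq_Icc]
    exact Finset.finite_toSet _
  rw [← Finset.card_image_of_injective F (sub_left_injective (b := x₀)), ← Set.ncard_coe_finset]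
  refine Nat.cast_le.2 (Set.ncard_le_ncard ?_ (hfin.subset Set.inter_subset_right))
  intro z hz
  obtain ⟨x, hx, rfl⟩ := Finset.mem_image.1 (Finset.mem_coe.1 hz)
  rw [hF, Finset.mem_filter] at hx hx₀
  have hxy := hx.2.trans hx₀.2.symm
  rw [Prod.mk.injEq] at hxy
  refine ⟨⟨?_, ?_⟩, fun i => ?_⟩
  · rw [map_sub]
    exact hclose _ _ hxy.1
  · rw [map_sub]
    exact hclose _ _ hxy.2
  · have hxQ : x ∈ {x : Fin d → ℤ | ∀ i, |x i - (0 : Fin d → ℤ) i| ≤ (N : ℤ)} := by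
      rw [setOf_abs_sub_le_eq_Icc]
      exact hx.1
    simpa using hxQ i

/-- **Necessity of the degree condition in the multidimensional polynomial Bogolyubov
theorem.** Let `P = (P₁, …, P_d) : ℤ^d → ℤ^d` be an integer polynomial map with zero
constant term such that some non-trivial integer linear combination `Σ αᵢ Pᵢ` is a linear
form `Σ βᵢ xᵢ`. Then there is `E ⊆ ℤ^d` with `d*(E) > 0` such that for every positive
integer `k` one has `kℤ^d ⊄ (E − E) + P(E − E)`. -/
theorem degree_condition_necessary_in_bogolyubov
    (d : ℕ) (p : Fin d → MvPolynomial (Fin d) ℤ)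
    (hp0 : ∀ i, MvPolynomial.constantCoeff (p i) = 0)
    (α : Fin d → ℤ) (hα : α ≠ 0) (β : Fin d → ℤ)
    (hlin : ∀ x : Fin d → ℤ, ∑ i, α i * MvPolynomial.eval x (p i) = ∑ i, β i * x i) :
    ∃ E : Set (Fin d → ℤ), 0 < upperBanachDensity d E ∧
      ∀ k : ℕ, 0 < k →
        ∃ m : Fin d → ℤ, ∀ x₁ ∈ E, ∀ x₂ ∈ E, ∀ y₁ ∈ E, ∀ y₂ ∈ E,
          (k : ℤ) • m ≠ (x₁ - x₂) + fun i => MvPolynomial.eval (y₁ - y₂) (p i) := by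
  let form : (Fin d → ℤ) → (Fin d → ℤ) →+ ℝ := fun γ =>
    { toFun := fun x => √2 * ((γ ⬝ᵥ x : ℤ) : ℝ)
      map_zero' := by simp
      map_add' := fun x y => by simp [dotProduct_add, mul_add] }
  refine ⟨_, upperBanachDensity_bohr_pos (M := 16) (by norm_num) (form α) (form β),
    fun k hk => ?_⟩
  obtain ⟨i, hi⟩ := Function.ne_iff.1 hα
  have hirr : Irrational (√2 * ((k * α i : ℤ) : ℝ)) :=
    irrational_sqrt_two.mul_intCast (mul_ne_zero (by exact_mod_cast hk.ne') hi)
  obtain ⟨n, hn⟩ := hirr.exists_quarter_le_abs_mul_sub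
  refine ⟨Pi.single i n, ?_⟩
  rintro x₁ ⟨⟨a₁, h₁⟩, -⟩ x₂ ⟨⟨a₂, h₂⟩, -⟩ y₁ ⟨-, b₁, h₃⟩ y₂ ⟨-, b₂, h₄⟩ heq
  have hdot : (k : ℤ) * (α i * n) = α ⬝ᵥ x₁ - α ⬝ᵥ x₂ + (β ⬝ᵥ y₁ - β ⬝ᵥ y₂) := by
    have h := congrArg (α ⬝ᵥ ·) heq
    have hl : (α ⬝ᵥ fun i => MvPolynomial.eval (y₁ - y₂) (p i)) = β ⬝ᵥ (y₁ - y₂) :=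
      hlin (y₁ - y₂)
    simpa only [dotProduct_smul, dotProduct_single, dotProduct_add, hl, dotProduct_sub,
      smul_eq_mul] using h
  have hreal : (n : ℝ) * (√2 * ((k * α i : ℤ) : ℝ)) =
      form α x₁ - form α x₂ + (form β y₁ - form β y₂) := by
    have h : ((k * (α i * n) : ℤ) : ℝ) =
        ((α ⬝ᵥ x₁ - α ⬝ᵥ x₂ + (β ⬝ᵥ y₁ - β ⬝ᵥ y₂) : ℤ) : ℝ) := by rw [hdot]
    simp only [form, AddMonoidHom.coe_mk, ZeroHom.coe_mk]
    push_cast at h ⊢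
    linear_combination √2 * h
  have hlarge := hn (a₁ - a₂ + (b₁ - b₂))
  rw [hreal, ← not_lt] at hlarge
  apply hlarge
  push_cast at *
  rw [abs_lt] at *
  constructor <;> linarith
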